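/- Let (A_T) ⊂ ℝ^{a×a} be symmetric matrices and (B_T) ⊂ ℝ^{a×b}, partitioned into 2×2 blocks with top-left blocks of size c×c, as A_T = [[A⁰₁₁+δᴬ₁₁, δᴬ₁₂],[δᴬ₂₁, A⁰₂₂+δᴬ₂₂]] and B_T = [[B⁰₁₁+δᴮ₁₁, δᴮ₁₂],[δᴮ₂₁, B⁰₂₂+δᴮ₂₂]], where the (possibly T-dependent) matrices A⁰₁₁, A⁰₂₂, B⁰₁₁, B⁰₂₂ are O(1) with A⁰₁₁ and A⁰₂₂ invertible and (A⁰₁₁)⁻¹ = O(1), (A⁰₂₂)⁻¹ = O(1), and where δᴬ₁₁ = O(a_T²), δᴬ₁₂ = O(a_T), δᴬ₂₁ = O(a_T), δᴬ₂₂ = O(a_T), δᴮ₁₁ = O(b_T²), δᴮ₁₂ = O(b_T), δᴮ₂₁ = O(b_T), δᴮ₂₂ = O(b_T) for positive reals a_T → 0, b_T → 0. Then for all sufficiently large T the matrices A_T and A₀ := diag(A⁰₁₁, A⁰₂₂) are invertible, and J_T := B_Tᵀ A_T⁻¹ B_T − B₀ᵀ A₀⁻¹ B₀ (with B₀ :=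 diag(B⁰₁₁, B⁰₂₂)) satisfies: J_{T,11} = (δᴮ₁₁)ᵀ(A⁰₁₁)⁻¹B⁰₁₁ + (B⁰₁₁)ᵀ(A⁰₁₁)⁻¹δᴮ₁₁ − (B⁰₁₁)ᵀ(A⁰₁₁)⁻¹δᴬ₁₁(A⁰₁₁)⁻¹B⁰₁₁ + [(δᴮ₂₁)ᵀ − (B⁰₁₁)ᵀ(A⁰₁₁)⁻¹δᴬ₁₂](A⁰₂₂)⁻¹[δᴮ₂₁ − δᴬ₂₁(A⁰₁₁)⁻¹B⁰₁₁] + o(a_T²+b_T²); J_{T,21} = (δᴮ₁₂)ᵀ(A⁰₁₁)⁻¹B⁰₁₁ + [B⁰₂₂+δᴮ₂₂]ᵀ(A⁰₂₂)⁻¹[δᴮ₂₁ − δᴬ₂₁(A⁰₁₁)⁻¹B⁰₁₁] − (B⁰₂₂)ᵀ(A⁰₂₂)⁻¹δᴬ₂₂(A⁰₂₂)⁻¹[δᴮ₂₁ − δᴬ₂₁(A⁰₁₁)⁻¹B⁰₁₁] + o(a_T²+b_T²); and, with E := δᴮ₂₂ − δᴬ₂₁(A⁰₁₁)⁻¹δᴮ₁₂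 and D := δᴬ₂₂ − δᴬ₂₁(A⁰₁₁)⁻¹δᴬ₁₂ − δᴬ₂₂(A⁰₂₂)⁻¹δᴬ₂₂, J_{T,22} = Eᵀ((A⁰₂₂)⁻¹ − (A⁰₂₂)⁻¹D(A⁰₂₂)⁻¹)B⁰₂₂ + (B⁰₂₂)ᵀ((A⁰₂₂)⁻¹ − (A⁰₂₂)⁻¹D(A⁰₂₂)⁻¹)E − (B⁰₂₂)ᵀ(A⁰₂₂)⁻¹D(A⁰₂₂)⁻¹B⁰₂₂ + Eᵀ(A⁰₂₂)⁻¹E + (δᴮ₁₂)ᵀ(A⁰₁₁)⁻¹δᴮ₁₂ + o(a_T²+b_T²). In particular J_{T,11} = O(a_T²+b_T²) and J_{T,21} = O(a_T+b_T), J_{T,22} = O(a_T+b_T). -/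

import Mathlib

open Filter Matrix Topology

/-- Frobenius norm of a real matrix. -/
noncomputable def frob {α β : Type*} [Fintype α] [Fintype β] (A : Matrix α β ℝ) : ℝ :=
  Real.sqrt (∑ i, ∑ j, (A i j) ^ 2)

/-- `F T = O(g T)` : the norm of `F T` divided by `g T` stays bounded. -/
def MBigO {α β : Type*} [Fintype α] [Fintype β] (F : ℕ → Matrix α β ℝ) (g : ℕ → ℝ) : Prop :=
  ∃ C : ℝ, ∀ᶠ T in atTop, frob (F T) ≤ C * g T

/-- `F T = o(g T)` : the norm of `F T` divided by `g T` tends to zero. -/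
def MLittleO {α β : Type*} [Fintype α] [Fintype β] (F : ℕ → Matrix α β ℝ) (g : ℕ → ℝ) : Prop :=
  Tendsto (fun T => frob (F T) / g T) atTop (𝓝 0)

section Frobenius

attribute [local instance] Matrix.frobeniusNormedAddCommGroup

variable {α β γ : Type*} [Fintype α] [Fintype β] [Fintype γ]

theorem frob_eq_norm (A : Matrix α β ℝ) : frob A = ‖A‖ := by
  simp [frob, Matrix.frobenius_norm_def, Real.sqrt_eq_rpow]

theorem frob_nonneg (A : Matrix α β ℝ) : 0 ≤ frob A := Real.sqrt_nonneg _

theorem frob_add_le (A B : Matrix α β ℝ) : frob (A + B) ≤ frob A + frob B := by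
  simpa only [frob_eq_norm] using norm_add_le A B

theorem frob_neg (A : Matrix α β ℝ) : frob (-A) = frob A := by
  simp [frob]

theorem frob_transpose (A : Matrix α β ℝ) : frob Aᵀ = frob A := by
  simp only [frob_eq_norm, Matrix.frobenius_norm_transpose]

theorem frob_mul_le (A : Matrix α β ℝ) (B : Matrix β γ ℝ) :
    frob (A * B) ≤ frob A * frob B := by
  simpa only [frob_eq_norm] using Matrix.frobenius_norm_mul A B

theorem isUnit_one_add_of_frob_lt_one [DecidableEq α] {A : Matrix α α ℝ} (h : frob A < 1) :
    IsUnit (1 + A) := by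
  let : NormedRing (Matrix α α ℝ) := Matrix.frobeniusNormedRing
  let : NormedAlgebra ℝ (Matrix α α ℝ) := Matrix.frobeniusNormedAlgebra
  have : CompleteSpace (Matrix α α ℝ) := FiniteDimensional.complete ℝ _
  have h' : ‖-A‖ < 1 := by
    rw [norm_neg]
    rwa [frob_eq_norm] at h
  simpa using isUnit_one_sub_of_norm_lt_one h'

end Frobenius

section Blocks

variable {α β γ δ : Type*} [Fintype α] [Fintype β] [Fintype γ] [Fintype δ]

theorem frob_sq (A : Matrix α β ℝ) : frob A ^ 2 = ∑ i, ∑ j, A i j ^ 2 :=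
  Real.sq_sqrt (by positivity)

theorem frob_fromBlocks_sq (A : Matrix α γ ℝ) (B : Matrix α δ ℝ) (C : Matrix β γ ℝ)
    (D : Matrix β δ ℝ) : frob (fromBlocks A B C D) ^ 2 =
      frob A ^ 2 + frob B ^ 2 + frob C ^ 2 + frob D ^ 2 := by
  simp only [frob_sq, Fintype.sum_sum_type, fromBlocks_apply₁₁, fromBlocks_apply₁₂,
    fromBlocks_apply₂₁, fromBlocks_apply₂₂, Finset.sum_add_distrib]
  ring

theorem frob_fromBlocks_le (A : Matrix α γ ℝ) (B : Matrix α δ ℝ) (C : Matrix β γ ℝ)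
    (D : Matrix β δ ℝ) :
    frob (fromBlocks A B C D) ≤ frob A + frob B + frob C + frob D := by
  have hA := frob_nonneg A
  have hB := frob_nonneg B
  have hC := frob_nonneg C
  have hD := frob_nonneg D
  refine le_of_sq_le_sq ?_ (by positivity)
  rw [frob_fromBlocks_sq]
  nlinarith [mul_nonneg hA hB, mul_nonneg hA hC, mul_nonneg hA hD, mul_nonneg hB hC,
    mul_nonneg hB hD, mul_nonneg hC hD]

theorem frob_toBlocks_sq (M : Matrix (α ⊕ β) (γ ⊕ δ) ℝ) : frob M ^ 2 =
    frob M.toBlocks₁₁ ^ 2 + frob M.toBlocks₁₂ ^ 2 + frob M.toBlocks₂₁ ^ 2 +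
      frob M.toBlocks₂₂ ^ 2 := by
  rw [← frob_fromBlocks_sq, fromBlocks_toBlocks]

end Blocks

/-- `F T` is of order `s T ^ k` in Frobenius norm. -/
def HasOrder {α β : Type*} [Fintype α] [Fintype β] (s : ℕ → ℝ) (F : ℕ → Matrix α β ℝ)
    (k : ℕ) : Prop :=
  (fun T => frob (F T)) =O[atTop] fun T => s T ^ k

namespace HasOrder

variable {α β γ δ : Type*} [Fintype α] [Fintype β] [Fintype γ] [Fintype δ] {s : ℕ → ℝ}
  {k l : ℕ}

theorem of_frob_le {F : ℕ → Matrix α β ℝ} {g : ℕ → ℝ} (hg : g =O[atTop] fun T => s T ^ k)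
    (h : ∀ T, frob (F T) ≤ g T) : HasOrder s F k := by
  refine (Asymptotics.IsBigO.of_norm_le fun T => ?_).trans hg
  rw [Real.norm_of_nonneg (frob_nonneg _)]
  exact h T

theorem congr {F G : ℕ → Matrix α β ℝ} (hF : HasOrder s F k) (h : ∀ᶠ T in atTop, G T = F T) :
    HasOrder s G k :=
  Asymptotics.IsBigO.congr' hF (h.mono fun T hT => by simp only [hT]) .rfl

theorem add {F G : ℕ → Matrix α β ℝ} (hF : HasOrder s F k) (hG : HasOrder s G k) :
    HasOrder s (fun T => F T + G T) k :=
  of_frob_le (Asymptotics.IsBigO.add hF hG) fun _ => frob_add_le _ _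

theorem neg {F : ℕ → Matrix α β ℝ} (hF : HasOrder s F k) : HasOrder s (fun T => -F T) k :=
  of_frob_le hF fun _ => (frob_neg _).le

theorem sub {F G : ℕ → Matrix α β ℝ} (hF : HasOrder s F k) (hG : HasOrder s G k) :
    HasOrder s (fun T => F T - G T) k := by
  simpa only [sub_eq_add_neg] using hF.add hG.neg

theorem transpose {F : ℕ → Matrix α β ℝ} (hF : HasOrder s F k) :
    HasOrder s (fun T => (F T)ᵀ) k :=
  of_frob_le hF fun _ => (frob_transpose _).le

theorem mul {F : ℕ → Matrix α β ℝ} {G : ℕ → Matrix β γ ℝ} (hF : HasOrder s F k)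
    (hG : HasOrder s G l) : HasOrder s (fun T => F T * G T) (k + l) := by
  refine of_frob_le ?_ fun _ => frob_mul_le _ _
  simpa only [pow_add] using Asymptotics.IsBigO.mul hF hG

theorem mono {F : ℕ → Matrix α β ℝ} (hF : HasOrder s F k) (hs : Tendsto s atTop (𝓝 0))
    (hkl : l ≤ k) : HasOrder s F l := by
  refine Asymptotics.IsBigO.trans hF ?_
  obtain ⟨m, rfl⟩ := Nat.exists_eq_add_of_le hkl
  simpa only [pow_add, mul_one, one_pow] using
    (Asymptotics.isBigO_refl (fun T => s T ^ l) atTop).mul ((hs.isBigO_one ℝ).pow m)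

theorem fromBlocks {F₁₁ : ℕ → Matrix α γ ℝ} {F₁₂ : ℕ → Matrix α δ ℝ} {F₂₁ : ℕ → Matrix β γ ℝ}
    {F₂₂ : ℕ → Matrix β δ ℝ} (h₁₁ : HasOrder s F₁₁ k) (h₁₂ : HasOrder s F₁₂ k)
    (h₂₁ : HasOrder s F₂₁ k) (h₂₂ : HasOrder s F₂₂ k) :
    HasOrder s (fun T => Matrix.fromBlocks (F₁₁ T) (F₁₂ T) (F₂₁ T) (F₂₂ T)) k :=
  of_frob_le (((Asymptotics.IsBigO.add h₁₁ h₁₂).add h₂₁).add h₂₂) fun _ =>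
    frob_fromBlocks_le _ _ _ _

theorem toBlocks {F : ℕ → Matrix (α ⊕ β) (γ ⊕ δ) ℝ} (hF : HasOrder s F k) :
    HasOrder s (fun T => (F T).toBlocks₁₁) k ∧ HasOrder s (fun T => (F T).toBlocks₁₂) k ∧
      HasOrder s (fun T => (F T).toBlocks₂₁) k ∧ HasOrder s (fun T => (F T).toBlocks₂₂) k := by
  refine ⟨?_, ?_, ?_, ?_⟩ <;>
  · refine of_frob_le hF fun T => le_of_sq_le_sq ?_ (frob_nonneg _)
    rw [frob_toBlocks_sq (F T)]
    nlinarith [sq_nonneg (frob (F T).toBlocks₁₁), sq_nonneg (frob (F T).toBlocks₁₂),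
      sq_nonneg (frob (F T).toBlocks₂₁), sq_nonneg (frob (F T).toBlocks₂₂)]

theorem zero : HasOrder s (fun _ => (0 : Matrix α β ℝ)) k := by
  simpa [HasOrder, frob] using Asymptotics.isBigO_zero _ _

theorem tendsto_frob {F : ℕ → Matrix α β ℝ} (hF : HasOrder s F (k + 1))
    (hs : Tendsto s atTop (𝓝 0)) : Tendsto (fun T => frob (F T)) atTop (𝓝 0) := by
  refine Asymptotics.IsBigO.trans_tendsto (hF.mono hs (Nat.le_add_left 1 k)) ?_
  simpa using hs

theorem mBigO {F : ℕ → Matrix α β ℝ} {g : ℕ → ℝ} (hF : HasOrder s F k) (hg : ∀ T, 0 ≤ g T)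
    (hsg : (fun T => s T ^ k) =O[atTop] g) : MBigO F g := by
  obtain ⟨C, hC⟩ := (Asymptotics.IsBigO.trans hF hsg).bound
  refine ⟨C, hC.mono fun T hT => ?_⟩
  rwa [Real.norm_of_nonneg (frob_nonneg _), Real.norm_of_nonneg (hg T)] at hT

theorem mLittleO {F : ℕ → Matrix α β ℝ} {g : ℕ → ℝ} (hF : HasOrder s F (k + 1))
    (hs : Tendsto s atTop (𝓝 0)) (hsg : (fun T => s T ^ k) =O[atTop] g) : MLittleO F g := by
  refine Asymptotics.IsLittleO.tendsto_div_nhds_zero (Asymptotics.IsBigO.trans_isLittleO hF ?_)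
  have h := hsg.mul_isLittleO ((Asymptotics.isLittleO_one_iff ℝ).2 hs)
  simpa only [pow_succ, mul_one] using h

end HasOrder

theorem MBigO.hasOrder {α β : Type*} [Fintype α] [Fintype β] {F : ℕ → Matrix α β ℝ}
    {g s : ℕ → ℝ} {k : ℕ} (hF : MBigO F g) (hg : ∀ T, 0 ≤ g T) (hgs : ∀ T, g T ≤ s T ^ k) :
    HasOrder s F k := by
  obtain ⟨C, hC⟩ := hF
  have h₁ : (fun T => frob (F T)) =O[atTop] g := by
    refine Asymptotics.IsBigO.of_bound C (hC.mono fun T hT => ?_)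
    rwa [Real.norm_of_nonneg (frob_nonneg _), Real.norm_of_nonneg (hg T)]
  refine h₁.trans (Asymptotics.IsBigO.of_norm_le fun T => ?_)
  rw [Real.norm_of_nonneg (hg T)]
  exact hgs T

/-- A perturbation tending to zero of invertible matrices with bounded inverses is eventually
invertible, and its inverse is bounded. -/
theorem eventually_isUnit_and_hasOrder_inv {α : Type*} [Fintype α] [DecidableEq α] {s : ℕ → ℝ}
    {A Δ : ℕ → Matrix α α ℝ} (hs : Tendsto s atTop (𝓝 0)) (hA : ∀ T, IsUnit (A T))
    (hAinv : HasOrder s (fun T => (A T)⁻¹) 0) (hΔ : HasOrder s Δ 1) :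
    (∀ᶠ T in atTop, IsUnit (A T + Δ T)) ∧ HasOrder s (fun T => (A T + Δ T)⁻¹) 0 := by
  have hfac : ∀ T, A T + Δ T = A T * (1 + (A T)⁻¹ * Δ T) := fun T => by
    rw [Matrix.mul_add, Matrix.mul_one,
      Matrix.mul_nonsing_inv_cancel_left _ _ ((Matrix.isUnit_iff_isUnit_det _).1 (hA T))]
  have hsmall : ∀ᶠ T in atTop, frob ((A T)⁻¹ * Δ T) < 1 / 2 :=
    ((hAinv.mul hΔ).tendsto_frob (k := 0) hs).eventually_lt_const (by norm_num)
  have hunit : ∀ᶠ T in atTop, IsUnit (A T + Δ T) := hsmall.mono fun T hT => by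
    rw [hfac]
    exact (hA T).mul (isUnit_one_add_of_frob_lt_one (by linarith))
  refine ⟨hunit, Asymptotics.IsBigO.trans (.of_bound 2 ?_) hAinv⟩
  filter_upwards [hsmall, hunit] with T hT hU
  rw [Real.norm_of_nonneg (frob_nonneg _), Real.norm_of_nonneg (frob_nonneg _)]
  have hN : (A T + Δ T)⁻¹ = (A T)⁻¹ + -((A T)⁻¹ * Δ T * (A T + Δ T)⁻¹) := by
    have h₁ := Matrix.mul_nonsing_inv _ ((Matrix.isUnit_iff_isUnit_det _).1 hU)
    have h₂ := Matrix.nonsing_inv_mul _ ((Matrix.isUnit_iff_isUnit_det _).1 (hA T))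
    have h₃ := congrArg (fun X => (A T)⁻¹ * X) h₁
    simp only [Matrix.add_mul, Matrix.mul_add, ← Matrix.mul_assoc, h₂, Matrix.one_mul,
      Matrix.mul_one] at h₃
    rw [← sub_eq_add_neg]
    exact eq_sub_of_add_eq h₃
  have h₁ := frob_add_le (A T)⁻¹ (-((A T)⁻¹ * Δ T * (A T + Δ T)⁻¹))
  rw [← hN, frob_neg] at h₁
  have h₂ := frob_mul_le ((A T)⁻¹ * Δ T) (A T + Δ T)⁻¹
  nlinarith [frob_nonneg (A T + Δ T)⁻¹]


/-- Lemma 4 of the paper — second-order block expansion of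
`B_Tᵀ A_T⁻¹ B_T` around the block-diagonal limit `B₀ᵀ A₀⁻¹ B₀`. -/
theorem stmt3 (c c2 d d2 : ℕ)
    (A011 dA11 : ℕ → Matrix (Fin c) (Fin c) ℝ)
    (dA12 : ℕ → Matrix (Fin c) (Fin c2) ℝ)
    (dA21 : ℕ → Matrix (Fin c2) (Fin c) ℝ)
    (A022 dA22 : ℕ → Matrix (Fin c2) (Fin c2) ℝ)
    (B011 dB11 : ℕ → Matrix (Fin c) (Fin d) ℝ)
    (dB12 : ℕ → Matrix (Fin c) (Fin d2) ℝ)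
    (dB21 : ℕ → Matrix (Fin c2) (Fin d) ℝ)
    (B022 dB22 : ℕ → Matrix (Fin c2) (Fin d2) ℝ)
    (AT : ℕ → Matrix (Fin c ⊕ Fin c2) (Fin c ⊕ Fin c2) ℝ)
    (hAT : ∀ T, AT T =
      Matrix.fromBlocks (A011 T + dA11 T) (dA12 T) (dA21 T) (A022 T + dA22 T))
    (BT : ℕ → Matrix (Fin c ⊕ Fin c2) (Fin d ⊕ Fin d2) ℝ)
    (hBT : ∀ T, BT T =
      Matrix.fromBlocks (B011 T + dB11 T) (dB12 T) (dB21 T) (B022 T + dB22 T))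
    (A0 : ℕ → Matrix (Fin c ⊕ Fin c2) (Fin c ⊕ Fin c2) ℝ)
    (hA0 : ∀ T, A0 T = Matrix.fromBlocks (A011 T) 0 0 (A022 T))
    (B0 : ℕ → Matrix (Fin c ⊕ Fin c2) (Fin d ⊕ Fin d2) ℝ)
    (hB0 : ∀ T, B0 T = Matrix.fromBlocks (B011 T) 0 0 (B022 T))
    (J : ℕ → Matrix (Fin d ⊕ Fin d2) (Fin d ⊕ Fin d2) ℝ)
    (hJ : ∀ T, J T = (BT T)ᵀ * (AT T)⁻¹ * BT T - (B0 T)ᵀ * (A0 T)⁻¹ * B0 T)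
    (E : ℕ → Matrix (Fin c2) (Fin d2) ℝ)
    (hE : ∀ T, E T = dB22 T - dA21 T * (A011 T)⁻¹ * dB12 T)
    (D : ℕ → Matrix (Fin c2) (Fin c2) ℝ)
    (hD : ∀ T, D T = dA22 T - dA21 T * (A011 T)⁻¹ * dA12 T - dA22 T * (A022 T)⁻¹ * dA22 T)
    (a b : ℕ → ℝ) (hapos : ∀ T, 0 < a T) (hbpos : ∀ T, 0 < b T)
    (ha : Tendsto a atTop (𝓝 0)) (hb : Tendsto b atTop (𝓝 0))
    (hsymm : ∀ T, (AT T)ᵀ = AT T)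
    (hA011O : MBigO A011 (fun _ => 1)) (hA022O : MBigO A022 (fun _ => 1))
    (hB011O : MBigO B011 (fun _ => 1)) (hB022O : MBigO B022 (fun _ => 1))
    (hA011U : ∀ T, IsUnit (A011 T)) (hA022U : ∀ T, IsUnit (A022 T))
    (hA011inv : MBigO (fun T => (A011 T)⁻¹) (fun _ => 1))
    (hA022inv : MBigO (fun T => (A022 T)⁻¹) (fun _ => 1))
    (h11 : MBigO dA11 (fun T => a T ^ 2)) (h12 : MBigO dA12 a)
    (h21 : MBigO dA21 a) (h22 : MBigO dA22 a)
    (g11 : MBigO dB11 (fun T => b T ^ 2)) (g12 : MBigO dB12 b)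
    (g21 : MBigO dB21 b) (g22 : MBigO dB22 b) :
    (∀ᶠ T in atTop, IsUnit (AT T) ∧ IsUnit (A0 T)) ∧
    MLittleO (fun T => Matrix.toBlocks₁₁ (J T) -
      ((dB11 T)ᵀ * (A011 T)⁻¹ * B011 T + (B011 T)ᵀ * (A011 T)⁻¹ * dB11 T
        - (B011 T)ᵀ * (A011 T)⁻¹ * dA11 T * (A011 T)⁻¹ * B011 T
        + ((dB21 T)ᵀ - (B011 T)ᵀ * (A011 T)⁻¹ * dA12 T) * (A022 T)⁻¹ *
            (dB21 T - dA21 T * (A011 T)⁻¹ * B011 T)))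
      (fun T => a T ^ 2 + b T ^ 2) ∧
    MLittleO (fun T => Matrix.toBlocks₂₁ (J T) -
      ((dB12 T)ᵀ * (A011 T)⁻¹ * B011 T
        + (B022 T + dB22 T)ᵀ * (A022 T)⁻¹ * (dB21 T - dA21 T * (A011 T)⁻¹ * B011 T)
        - (B022 T)ᵀ * (A022 T)⁻¹ * dA22 T * (A022 T)⁻¹ *
            (dB21 T - dA21 T * (A011 T)⁻¹ * B011 T)))
      (fun T => a T ^ 2 + b T ^ 2) ∧
    MLittleO (fun T => Matrix.toBlocks₂₂ (J T) -
      ((E T)ᵀ * ((A022 T)⁻¹ - (A022 T)⁻¹ * D T * (A022 T)⁻¹) * B022 T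
        + (B022 T)ᵀ * ((A022 T)⁻¹ - (A022 T)⁻¹ * D T * (A022 T)⁻¹) * E T
        - (B022 T)ᵀ * ((A022 T)⁻¹ * D T * (A022 T)⁻¹) * B022 T
        + (E T)ᵀ * (A022 T)⁻¹ * E T
        + (dB12 T)ᵀ * (A011 T)⁻¹ * dB12 T))
      (fun T => a T ^ 2 + b T ^ 2) ∧
    MBigO (fun T => Matrix.toBlocks₁₁ (J T)) (fun T => a T ^ 2 + b T ^ 2) ∧
    MBigO (fun T => Matrix.toBlocks₂₁ (J T)) (fun T => a T + b T) ∧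
    MBigO (fun T => Matrix.toBlocks₂₂ (J T)) (fun T => a T + b T) := by
  set s : ℕ → ℝ := fun T => a T + b T with hs_def
  have hs : Tendsto s atTop (𝓝 0) := by simpa using ha.add hb
  have has : ∀ T, a T ≤ s T ^ 1 := fun T => by
    simpa [hs_def] using (hbpos T).le
  have hbs : ∀ T, b T ≤ s T ^ 1 := fun T => by
    simpa [hs_def] using (hapos T).le
  have has2 : ∀ T, a T ^ 2 ≤ s T ^ 2 := fun T =>
    pow_le_pow_left₀ (hapos T).le (by simpa using has T) 2
  have hbs2 : ∀ T, b T ^ 2 ≤ s T ^ 2 := fun T =>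
    pow_le_pow_left₀ (hbpos T).le (by simpa using hbs T) 2
  have h1s : ∀ T, (1 : ℝ) ≤ s T ^ 0 := fun T => by simp
  have hs2 : (fun T => s T ^ 2) =O[atTop] fun T => a T ^ 2 + b T ^ 2 := by
    refine Asymptotics.IsBigO.of_bound 2 (.of_forall fun T => ?_)
    rw [Real.norm_of_nonneg (by positivity), Real.norm_of_nonneg (by positivity)]
    simp only [hs_def]
    nlinarith [sq_nonneg (a T - b T)]
  have hs1 : (fun T => s T ^ 1) =O[atTop] fun T => a T + b T := by
    simpa using Asymptotics.isBigO_refl s atTop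
  replace hB011O : HasOrder s B011 0 := hB011O.hasOrder (fun _ => zero_le_one) h1s
  replace hB022O : HasOrder s B022 0 := hB022O.hasOrder (fun _ => zero_le_one) h1s
  replace hA011inv : HasOrder s (fun T => (A011 T)⁻¹) 0 :=
    hA011inv.hasOrder (fun _ => zero_le_one) h1s
  replace hA022inv : HasOrder s (fun T => (A022 T)⁻¹) 0 :=
    hA022inv.hasOrder (fun _ => zero_le_one) h1s
  replace h11 : HasOrder s dA11 2 := h11.hasOrder (fun _ => sq_nonneg _) has2
  replace h12 : HasOrder s dA12 1 := h12.hasOrder (fun T => (hapos T).le) has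
  replace h21 : HasOrder s dA21 1 := h21.hasOrder (fun T => (hapos T).le) has
  replace h22 : HasOrder s dA22 1 := h22.hasOrder (fun T => (hapos T).le) has
  replace g11 : HasOrder s dB11 2 := g11.hasOrder (fun _ => sq_nonneg _) hbs2
  replace g12 : HasOrder s dB12 1 := g12.hasOrder (fun T => (hbpos T).le) hbs
  replace g21 : HasOrder s dB21 1 := g21.hasOrder (fun T => (hbpos T).le) hbs
  replace g22 : HasOrder s dB22 1 := g22.hasOrder (fun T => (hbpos T).le) hbs
  have hA11sub : ∀ T, A011 T - (A011 T)ᵀ = (dA11 T)ᵀ - dA11 T := fun T => by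
    have h := congrArg Matrix.toBlocks₁₁ (hsymm T)
    simp only [hAT, fromBlocks_transpose, toBlocks_fromBlocks₁₁, Matrix.transpose_add] at h
    rw [sub_eq_sub_iff_add_eq_add, add_comm (dA11 T)ᵀ, h]
  have hA21t : ∀ T, (dA21 T)ᵀ = dA12 T := fun T => by
    have h := congrArg Matrix.toBlocks₁₂ (hsymm T)
    simpa only [hAT, fromBlocks_transpose, toBlocks_fromBlocks₁₂] using h
  have hU1 : ∀ T, IsUnit (A011 T).det := fun T => (Matrix.isUnit_iff_isUnit_det _).1 (hA011U T)
  have hU2 : ∀ T, IsUnit (A022 T).det := fun T => (Matrix.isUnit_iff_isUnit_det _).1 (hA022U T)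
  have hA0U : ∀ T, IsUnit (A0 T) := fun T => by
    rw [hA0, Matrix.isUnit_iff_isUnit_det, Matrix.det_fromBlocks_zero₂₁]
    exact (hU1 T).mul (hU2 T)
  have hA0inv : ∀ T, (A0 T)⁻¹ = Matrix.fromBlocks (A011 T)⁻¹ 0 0 (A022 T)⁻¹ := fun T => by
    refine Matrix.inv_eq_right_inv ?_
    simp [hA0, Matrix.fromBlocks_multiply, Matrix.mul_nonsing_inv _ (hU1 T),
      Matrix.mul_nonsing_inv _ (hU2 T)]
  obtain ⟨hATU, hN⟩ := eventually_isUnit_and_hasOrder_inv (s := s) (A := A0)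
    (Δ := fun T => Matrix.fromBlocks (dA11 T) (dA12 T) (dA21 T) (dA22 T)) hs hA0U
    (by simpa only [hA0inv] using hA011inv.fromBlocks .zero .zero hA022inv)
    ((h11.mono hs one_le_two).fromBlocks h12 h21 h22)
  have hAsum : ∀ T, A0 T + Matrix.fromBlocks (dA11 T) (dA12 T) (dA21 T) (dA22 T) = AT T :=
    fun T => by simp [hA0, hAT, Matrix.fromBlocks_add]
  simp only [hAsum] at hATU hN
  obtain ⟨hN11, hN12, hN21, hN22⟩ := hN.toBlocks
  obtain ⟨P, hP⟩ : ∃ P : ℕ → Matrix (Fin c) (Fin c) ℝ, P = fun T => (A011 T)⁻¹ := ⟨_, rfl⟩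
  obtain ⟨Q, hQ⟩ : ∃ Q : ℕ → Matrix (Fin c2) (Fin c2) ℝ, Q = fun T => (A022 T)⁻¹ := ⟨_, rfl⟩
  have hPT : ∀ T, (A011 T)⁻¹ = P T := fun T => by rw [hP]
  have hQT : ∀ T, (A022 T)⁻¹ = Q T := fun T => by rw [hQ]
  have hPA : ∀ T, P T * A011 T = 1 := fun T => by rw [hP]; exact Matrix.nonsing_inv_mul _ (hU1 T)
  have hAP : ∀ T, A011 T * P T = 1 := fun T => by rw [hP]; exact Matrix.mul_nonsing_inv _ (hU1 T)
  have hQA : ∀ T, Q T * A022 T = 1 := fun T => by rw [hQ]; exact Matrix.nonsing_inv_mul _ (hU2 T)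
  simp only [hPT, hQT] at hA011inv hA022inv hA0inv hE hD ⊢
  clear hPT hQT hP hQ
  obtain ⟨N11, hN11e⟩ : ∃ N, N = fun T => ((AT T)⁻¹).toBlocks₁₁ := ⟨_, rfl⟩
  obtain ⟨N12, hN12e⟩ : ∃ N, N = fun T => ((AT T)⁻¹).toBlocks₁₂ := ⟨_, rfl⟩
  obtain ⟨N21, hN21e⟩ : ∃ N, N = fun T => ((AT T)⁻¹).toBlocks₂₁ := ⟨_, rfl⟩
  obtain ⟨N22, hN22e⟩ : ∃ N, N = fun T => ((AT T)⁻¹).toBlocks₂₂ := ⟨_, rfl⟩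
  have hNB : ∀ T, (AT T)⁻¹ = Matrix.fromBlocks (N11 T) (N12 T) (N21 T) (N22 T) := fun T => by
    simp only [hN11e, hN12e, hN21e, hN22e, Matrix.fromBlocks_toBlocks]
  rw [← hN11e] at hN11
  rw [← hN12e] at hN12
  rw [← hN21e] at hN21
  rw [← hN22e] at hN22
  clear hN11e hN12e hN21e hN22e
  -- The block form of the resolvent identity.
  have hres : ∀ᶠ T in atTop,
      N11 T = P T - P T * dA11 T * N11 T - P T * dA12 T * N21 T ∧
      N12 T = - (P T * dA11 T * N12 T) - P T * dA12 T * N22 T ∧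
      N21 T = - (Q T * dA21 T * N11 T) - Q T * dA22 T * N21 T ∧
      N22 T = Q T - Q T * dA21 T * N12 T - Q T * dA22 T * N22 T := by
    filter_upwards [hATU] with T hT
    have h := Matrix.mul_nonsing_inv _ ((Matrix.isUnit_iff_isUnit_det _).1 hT)
    rw [hNB, hAT, Matrix.fromBlocks_multiply, ← Matrix.fromBlocks_one,
      Matrix.fromBlocks_inj] at h
    obtain ⟨e1, e2, e3, e4⟩ := h
    replace e1 := congrArg (fun X => P T * X) e1
    replace e2 := congrArg (fun X => P T * X) e2
    replace e3 := congrArg (fun X => Q T * X) e3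
    replace e4 := congrArg (fun X => Q T * X) e4
    simp only [Matrix.add_mul, Matrix.mul_add, ← Matrix.mul_assoc, hPA, hQA, Matrix.one_mul,
      Matrix.mul_one, Matrix.mul_zero] at e1 e2 e3 e4
    refine ⟨?_, ?_, ?_, ?_⟩
    · rw [sub_sub, eq_sub_iff_add_eq, ← add_assoc, e1]
    · rw [← sub_eq_zero, ← e2]; abel
    · rw [← sub_eq_zero, ← e3]; abel
    · rw [sub_sub, eq_sub_iff_add_eq, add_left_comm, e4]
  -- Successive approximations of the blocks of the inverse.
  have k21 : HasOrder s N21 1 := by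
    refine HasOrder.congr (((hA022inv.mul h21).mul hN11).neg.sub
      ((hA022inv.mul h22).mul hN21)) ?_
    filter_upwards [hres] with T hT using hT.2.2.1
  have k12 : HasOrder s N12 1 := by
    refine HasOrder.congr ((((hA011inv.mul h11).mul hN12).mono hs (by norm_num)).neg.sub
      ((hA011inv.mul h12).mul hN22)) ?_
    filter_upwards [hres] with T hT using hT.2.1
  have n11 : HasOrder s (fun T => N11 T - P T) 2 := by
    refine HasOrder.congr (((hA011inv.mul h11).mul hN11).neg.sub
      ((hA011inv.mul h12).mul k21)) ?_
    filter_upwards [hres] with T hT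
    nth_rw 1 [hT.1]
    abel
  have m22 : HasOrder s (fun T => N22 T - Q T) 1 := by
    refine HasOrder.congr ((((hA022inv.mul h21).mul k12).mono hs (by norm_num)).neg.sub
      ((hA022inv.mul h22).mul hN22)) ?_
    filter_upwards [hres] with T hT
    nth_rw 1 [hT.2.2.2]
    abel
  have m21 : HasOrder s (fun T => N21 T + Q T * dA21 T * P T) 2 := by
    refine HasOrder.congr ((((hA022inv.mul h21).mul n11).mono hs (by norm_num)).neg.sub
      ((hA022inv.mul h22).mul k21)) ?_
    filter_upwards [hres] with T hT
    nth_rw 1 [hT.2.2.1]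
    simp only [Matrix.mul_sub]
    abel
  have m12 : HasOrder s (fun T => N12 T + P T * dA12 T * Q T) 2 := by
    refine HasOrder.congr ((((hA011inv.mul h11).mul k12).mono hs (by norm_num)).neg.sub
      ((hA011inv.mul h12).mul m22)) ?_
    filter_upwards [hres] with T hT
    nth_rw 1 [hT.2.1]
    simp only [Matrix.mul_sub]
    abel
  have l22 : HasOrder s (fun T => N22 T - Q T + Q T * dA22 T * Q T) 2 := by
    refine HasOrder.congr (((hA022inv.mul h21).mul k12).neg.sub
      ((hA022inv.mul h22).mul m22)) ?_
    filter_upwards [hres] with T hT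
    nth_rw 1 [hT.2.2.2]
    simp only [Matrix.mul_sub]
    abel
  have r11 : HasOrder s (fun T => N11 T -
      (P T - P T * dA11 T * P T + P T * dA12 T * (Q T * dA21 T * P T))) 3 := by
    refine HasOrder.congr ((((hA011inv.mul h11).mul n11).mono hs (by norm_num)).neg.sub
      ((hA011inv.mul h12).mul m21)) ?_
    filter_upwards [hres] with T hT
    nth_rw 1 [hT.1]
    simp only [Matrix.mul_sub, Matrix.mul_add]
    abel
  have r21 : HasOrder s (fun T => N21 T + Q T * dA21 T * P T -
      Q T * dA22 T * (Q T * dA21 T * P T)) 3 := by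
    refine HasOrder.congr (((hA022inv.mul h21).mul n11).neg.sub
      ((hA022inv.mul h22).mul m21)) ?_
    filter_upwards [hres] with T hT
    nth_rw 1 [hT.2.2.1]
    simp only [Matrix.mul_sub, Matrix.mul_add]
    abel
  have r22 : HasOrder s (fun T => N22 T - (Q T - Q T * D T * Q T)) 3 := by
    refine HasOrder.congr (((hA022inv.mul h21).mul m12).neg.sub
      ((hA022inv.mul h22).mul l22)) ?_
    filter_upwards [hres] with T hT
    nth_rw 1 [hT.2.2.2]
    simp only [hD, Matrix.mul_sub, Matrix.mul_add, Matrix.sub_mul, Matrix.mul_assoc]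
    abel
  have hPsymm : HasOrder s (fun T => (P T)ᵀ - P T) 2 := by
    refine HasOrder.congr ((hA011inv.transpose.mul (h11.transpose.sub h11)).mul hA011inv)
      (.of_forall fun T => ?_)
    have h : (P T)ᵀ * (A011 T)ᵀ = 1 := by rw [← Matrix.transpose_mul, hAP, Matrix.transpose_one]
    rw [← hA11sub, Matrix.mul_sub, Matrix.sub_mul, h, Matrix.mul_assoc, hAP, Matrix.mul_one,
      Matrix.one_mul]
  have hEo : HasOrder s E 1 := by
    refine HasOrder.congr (g22.sub (((h21.mul hA011inv).mul g12).mono hs (by norm_num)))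
      (.of_forall hE)
  have hDo : HasOrder s D 1 := by
    refine HasOrder.congr ((h22.sub (((h21.mul hA011inv).mul h12).mono hs (by norm_num))).sub
      (((h22.mul hA022inv).mul h22).mono hs (by norm_num))) (.of_forall hD)
  have hJB : ∀ T, J T = Matrix.fromBlocks
      ((B011 T + dB11 T)ᵀ * N11 T * (B011 T + dB11 T) + (dB21 T)ᵀ * N21 T * (B011 T + dB11 T)
        + ((B011 T + dB11 T)ᵀ * N12 T * dB21 T + (dB21 T)ᵀ * N22 T * dB21 T)
        - (B011 T)ᵀ * P T * B011 T)
      ((B011 T + dB11 T)ᵀ * N11 T * dB12 T + (dB21 T)ᵀ * N21 T * dB12 T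
        + ((B011 T + dB11 T)ᵀ * N12 T * (B022 T + dB22 T)
          + (dB21 T)ᵀ * N22 T * (B022 T + dB22 T)))
      ((dB12 T)ᵀ * N11 T * (B011 T + dB11 T) + (B022 T + dB22 T)ᵀ * N21 T * (B011 T + dB11 T)
        + ((dB12 T)ᵀ * N12 T * dB21 T + (B022 T + dB22 T)ᵀ * N22 T * dB21 T))
      ((dB12 T)ᵀ * N11 T * dB12 T + (B022 T + dB22 T)ᵀ * N21 T * dB12 T
        + ((dB12 T)ᵀ * N12 T * (B022 T + dB22 T)
          + (B022 T + dB22 T)ᵀ * N22 T * (B022 T + dB22 T))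
        - (B022 T)ᵀ * Q T * B022 T) := fun T => by
    rw [hJ, hNB, hA0inv, hBT, hB0, Matrix.fromBlocks_transpose, Matrix.fromBlocks_transpose,
      Matrix.fromBlocks_multiply, Matrix.fromBlocks_multiply, Matrix.fromBlocks_multiply,
      Matrix.fromBlocks_multiply, sub_eq_add_neg, Matrix.fromBlocks_neg,
      Matrix.fromBlocks_add]
    simp only [Matrix.transpose_zero, Matrix.mul_zero, Matrix.zero_mul, add_zero, zero_add,
      neg_zero, Matrix.add_mul, sub_eq_add_neg]
  have hJ11 : ∀ T, (J T).toBlocks₁₁ = _ := fun T => by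
    rw [hJB, Matrix.toBlocks_fromBlocks₁₁]
  have hJ21 : ∀ T, (J T).toBlocks₂₁ = _ := fun T => by
    rw [hJB, Matrix.toBlocks_fromBlocks₂₁]
  have hJ22 : ∀ T, (J T).toBlocks₂₂ = _ := fun T => by
    rw [hJB, Matrix.toBlocks_fromBlocks₂₂]
  have hB1 := hB011O.add (g11.mono hs (by norm_num))
  have hB2 := hB022O.add (g22.mono hs (by norm_num))
  have hdiff := g21.sub ((h21.mul hA011inv).mul hB011O)
  have o11 : HasOrder s (fun T => Matrix.toBlocks₁₁ (J T) -
      ((dB11 T)ᵀ * P T * B011 T + (B011 T)ᵀ * P T * dB11 T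
        - (B011 T)ᵀ * P T * dA11 T * P T * B011 T
        + ((dB21 T)ᵀ - (B011 T)ᵀ * P T * dA12 T) * Q T *
            (dB21 T - dA21 T * P T * B011 T))) 3 := by
    have t1 := ((g11.transpose.mul n11).mul hB1).mono hs (l := 3) (by norm_num)
    have t2 := ((g11.transpose.mul hA011inv).mul g11).mono hs (l := 3) (by norm_num)
    have t3 := ((hB011O.transpose.mul n11).mul g11).mono hs (l := 3) (by norm_num)
    have t4 := ((hB011O.transpose.mul r11).mul hB011O).mono hs (l := 3) (by norm_num)
    have t5 := ((g11.transpose.mul k12).mul g21).mono hs (l := 3) (by norm_num)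
    have t6 := ((hB011O.transpose.mul m12).mul g21).mono hs (l := 3) (by norm_num)
    have t7 := ((g21.transpose.mul k21).mul g11).mono hs (l := 3) (by norm_num)
    have t8 := ((g21.transpose.mul m21).mul hB011O).mono hs (l := 3) (by norm_num)
    have t9 := ((g21.transpose.mul m22).mul g21).mono hs (l := 3) (by norm_num)
    refine HasOrder.congr ((((((((t1.add t2).add t3).add t4).add t5).add t6).add t7).add t8).add t9)
      (.of_forall fun T => ?_)
    rw [hJ11]
    simp only [Matrix.transpose_add, Matrix.mul_sub, Matrix.mul_add, Matrix.sub_mul,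
      Matrix.add_mul, Matrix.mul_assoc]
    abel
  have o21 : HasOrder s (fun T => Matrix.toBlocks₂₁ (J T) -
      ((dB12 T)ᵀ * P T * B011 T
        + (B022 T + dB22 T)ᵀ * Q T * (dB21 T - dA21 T * P T * B011 T)
        - (B022 T)ᵀ * Q T * dA22 T * Q T * (dB21 T - dA21 T * P T * B011 T))) 3 := by
    have t1 := ((g12.transpose.mul n11).mul hB1).mono hs (l := 3) (by norm_num)
    have t2 := ((g12.transpose.mul hA011inv).mul g11).mono hs (l := 3) (by norm_num)
    have t3 := ((g12.transpose.mul k12).mul g21).mono hs (l := 3) (by norm_num)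
    have t4 := ((hB022O.transpose.mul r21).mul hB011O).mono hs (l := 3) (by norm_num)
    have t5 := ((g22.transpose.mul m21).mul hB011O).mono hs (l := 3) (by norm_num)
    have t6 := ((hB2.transpose.mul k21).mul g11).mono hs (l := 3) (by norm_num)
    have t7 := ((hB022O.transpose.mul l22).mul g21).mono hs (l := 3) (by norm_num)
    have t8 := ((g22.transpose.mul m22).mul g21).mono hs (l := 3) (by norm_num)
    refine HasOrder.congr (((((((t1.add t2).add t3).add t4).add t5).add t6).add t7).add t8)
      (.of_forall fun T => ?_)
    rw [hJ21]
    simp only [Matrix.transpose_add, Matrix.mul_sub, Matrix.mul_add, Matrix.sub_mul,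
      Matrix.add_mul, Matrix.mul_assoc]
    abel
  have o22 : HasOrder s (fun T => Matrix.toBlocks₂₂ (J T) -
      ((E T)ᵀ * (Q T - Q T * D T * Q T) * B022 T
        + (B022 T)ᵀ * (Q T - Q T * D T * Q T) * E T
        - (B022 T)ᵀ * (Q T * D T * Q T) * B022 T
        + (E T)ᵀ * Q T * E T
        + (dB12 T)ᵀ * P T * dB12 T)) 3 := by
    have he := (h21.mul hA011inv).mul g12
    have hQDQ := (hA022inv.mul hDo).mul hA022inv
    have t1 := ((g12.transpose.mul n11).mul g12).mono hs (l := 3) (by norm_num)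
    have t2 := ((g12.transpose.mul m12).mul hB022O).mono hs (l := 3) (by norm_num)
    have t3 := ((g12.transpose.mul k12).mul g22).mono hs (l := 3) (by norm_num)
    have t4 := (((g12.transpose.mul hPsymm).mul h12).mul (hA022inv.mul hB022O)).mono hs (l := 3)
      (by norm_num)
    have t5 := ((he.transpose.mul hQDQ).mul hB022O).mono hs (l := 3) (by norm_num)
    have t6 := ((hB022O.transpose.mul m21).mul g12).mono hs (l := 3) (by norm_num)
    have t7 := ((g22.transpose.mul k21).mul g12).mono hs (l := 3) (by norm_num)
    have t8 := ((hB022O.transpose.mul hQDQ).mul he).mono hs (l := 3) (by norm_num)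
    have t9 := ((hB2.transpose.mul r22).mul hB022O).mono hs (l := 3) (by norm_num)
    have t10 := ((hB022O.transpose.mul r22).mul g22).mono hs (l := 3) (by norm_num)
    have t11 := ((g22.transpose.mul m22).mul g22).mono hs (l := 3) (by norm_num)
    have t12 := ((he.transpose.mul hA022inv).mul g22).mono hs (l := 3) (by norm_num)
    have t13 := ((hEo.transpose.mul hA022inv).mul he).mono hs (l := 3) (by norm_num)
    refine HasOrder.congr ((((((((((((t1.add t2).add t3).add t4).sub t5).add t6).add t7).sub
      t8).add t9).add t10).add t11).add t12).add t13) (.of_forall fun T => ?_)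
    rw [hJ22]
    simp only [hE, hA21t, Matrix.transpose_add, Matrix.transpose_sub, Matrix.transpose_mul,
      Matrix.mul_sub, Matrix.mul_add, Matrix.sub_mul, Matrix.add_mul, Matrix.mul_assoc]
    abel
  have hsq : ∀ T, 0 ≤ a T ^ 2 + b T ^ 2 := fun T => by positivity
  have hsum : ∀ T, 0 ≤ a T + b T := fun T => (add_pos (hapos T) (hbpos T)).le
  refine ⟨hATU.mono fun T hT => ⟨hT, hA0U T⟩, o11.mLittleO hs hs2, o21.mLittleO hs hs2,
    o22.mLittleO hs hs2, ?_, ?_, ?_⟩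
  · have f1 := (g11.transpose.mul hA011inv).mul hB011O
    have f2 := (hB011O.transpose.mul hA011inv).mul g11
    have f3 := (((hB011O.transpose.mul hA011inv).mul h11).mul hA011inv).mul hB011O
    have f4 := ((g21.transpose.sub ((hB011O.transpose.mul hA011inv).mul h12)).mul hA022inv).mul
      hdiff
    exact (((o11.mono hs (by norm_num)).add (((f1.add f2).sub f3).add f4)).congr
      (.of_forall fun T => (sub_add_cancel _ _).symm)).mBigO hsq hs2
  · have f1 := (g12.transpose.mul hA011inv).mul hB011O
    have f2 := (hB2.transpose.mul hA022inv).mul hdiff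
    have f3 := ((((hB022O.transpose.mul hA022inv).mul h22).mul hA022inv).mul hdiff).mono hs (l := 1)
      (by norm_num)
    exact (((o21.mono hs (by norm_num)).add ((f1.add f2).sub f3)).congr
      (.of_forall fun T => (sub_add_cancel _ _).symm)).mBigO hsum hs1
  · have hQDQ := (hA022inv.mul hDo).mul hA022inv
    have hX := hA022inv.sub (hQDQ.mono hs (by norm_num))
    have f1 := (hEo.transpose.mul hX).mul hB022O
    have f2 := (hB022O.transpose.mul hX).mul hEo
    have f3 := (hB022O.transpose.mul hQDQ).mul hB022O
    have f4 := ((hEo.transpose.mul hA022inv).mul hEo).mono hs (l := 1) (by norm_num)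
    have f5 := ((g12.transpose.mul hA011inv).mul g12).mono hs (l := 1) (by norm_num)
    exact (((o22.mono hs (by norm_num)).add ((((f1.add f2).sub f3).add f4).add f5)).congr
      (.of_forall fun T => (sub_add_cancel _ _).symm)).mBigO hsum hs1
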